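/- Let ω = (−1 + i√3)/2 and let Q be an n×n nontrivial cube root Seidel matrix in standard form satisfying Q² = (n−1)·I + μ·Q for a real number μ. Then e := (n − μ − 2)/3 is an integer with e ≡ 0 (mod 3), and e satisfies 2n/9 ≤ e ≤ (4n − 9)/9 (equivalently, 2n ≤ 9e and 9e ≤ 4n − 9). -/

import Mathlib

/-- `ω = (−1 + i√3)/2`, a primitive cube root of unity. -/
noncomputable def ω3 : ℂ := (-1 + Complex.I * Real.sqrt 3) / 2

/-- A cube root Seidel matrix: self-adjoint, zero diagonal, off-diagonal
entries among the cube roots of unity. -/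
def IsCubeRootSeidel {n : ℕ} (Q : Matrix (Fin n) (Fin n) ℂ) : Prop :=
  Q.IsHermitian ∧ (∀ i, Q i i = 0) ∧
    ∀ i j, i ≠ j → Q i j = 1 ∨ Q i j = ω3 ∨ Q i j = ω3 ^ 2

/-- Standard form: every off-diagonal entry in the first row and first column
equals 1. -/
def IsStandardForm {n : ℕ} (Q : Matrix (Fin n) (Fin n) ℂ) : Prop :=
  ∀ i j : Fin n, i ≠ j → (i.val = 0 ∨ j.val = 0) → Q i j = 1

/-- Nontrivial: some off-diagonal entry is not equal to 1. -/
def IsNontrivial {n : ℕ} (Q : Matrix (Fin n) (Fin n) ℂ) : Prop :=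
  ∃ i j : Fin n, i ≠ j ∧ Q i j ≠ 1

/-- The number of `k ∈ s` with `x k = a` and `y k = b`. -/
def jointCount {ι : Type*} (s : Finset ι) (x y : ι → Fin 3) (a b : Fin 3) : ℕ :=
  (s.filter fun k => (x k, y k) = (a, b)).card

theorem sum_eq_sum_jointCount {ι : Type*} (s : Finset ι) (x y : ι → Fin 3)
    (F : Fin 3 → Fin 3 → ℂ) :
    ∑ k ∈ s, F (x k) (y k) = ∑ a, ∑ b, (jointCount s x y a b : ℂ) * F a b := by
  rw [← Finset.sum_fiberwise s (fun k => (x k, y k)), Fintype.sum_prod_type]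
  refine Finset.sum_congr rfl fun a _ => Finset.sum_congr rfl fun b _ => ?_
  rw [jointCount, ← nsmul_eq_mul, ← Finset.sum_const]
  refine Finset.sum_congr rfl fun k hk => ?_
  obtain ⟨rfl, rfl⟩ := Prod.mk.inj (Finset.mem_filter.mp hk).2
  rfl

theorem ω3_re : ω3.re = -1 / 2 := by
  simp [ω3]

theorem ω3_im : ω3.im = √3 / 2 := by
  simp [ω3]

theorem ω3_sq : ω3 ^ 2 = -1 - ω3 := by
  have h : ((√3 : ℝ) : ℂ) ^ 2 = 3 := by
    rw [← Complex.ofReal_pow, Real.sq_sqrt (by norm_num)]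
    norm_num
  rw [ω3]
  linear_combination (1 / 4 : ℂ) * Complex.I ^ 2 * h + (3 / 4 : ℂ) * Complex.I_sq

theorem star_ω3 : star ω3 = ω3 ^ 2 := by
  rw [ω3_sq]
  apply Complex.ext
  · simp [ω3_re]; norm_num
  · simp [ω3_im]

/-- The only real relations between `1`, `ω` and `ω²` are the multiples of `1 + ω + ω² = 0`. -/
theorem coeff_eq_of_add_mul_ω3_eq_zero {p q r : ℝ} (h : (p : ℂ) + q * ω3 + r * ω3 ^ 2 = 0) :
    p = r ∧ q = r := by
  rw [ω3_sq] at h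
  have hre := congrArg Complex.re h
  have him := congrArg Complex.im h
  simp [ω3_re, ω3_im] at hre him
  have hq : q = r := by
    have h3 : √3 ≠ 0 := by positivity
    apply mul_right_cancel₀ h3
    linarith
  exact ⟨by linarith, hq⟩

/-- A matrix `A` with `A² = D` for a positive real `D` has eigenvalues `±√D`, so its trace is an
integer multiple of `√D`. -/
theorem exists_int_trace_eq_mul_sqrt {ι : Type*} [Fintype ι] [DecidableEq ι] (A : Matrix ι ι ℂ)
    {D : ℝ} (hD : 0 < D) (hA : A * A = (D : ℂ) • 1) :
    ∃ k : ℤ, A.trace = k * (√D : ℝ) := by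
  have hd : ((√D : ℝ) : ℂ) ≠ 0 := by exact_mod_cast (Real.sqrt_pos.mpr hD).ne'
  have hdd : ((√D : ℝ) : ℂ) ^ 2 = D := by
    rw [← Complex.ofReal_pow, Real.sq_sqrt hD.le]
  set d : ℂ := ((√D : ℝ) : ℂ)
  set P : Matrix ι ι ℂ := (1 / 2 : ℂ) • 1 + (1 / (2 * d)) • A with hPdef
  have hP : P * P = P := by
    simp only [hPdef, add_mul, mul_add, smul_mul_assoc, mul_smul_comm, hA, one_mul, mul_one,
      smul_smul]
    rw [← hdd]
    match_scalars <;> field_simp <;> norm_num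
  have hlin : IsIdempotentElem (Matrix.toLin' P) := by
    rw [IsIdempotentElem, Module.End.mul_eq_comp, ← Matrix.toLin'_mul, hP]
  have htr := ((LinearMap.isProj_range_iff_isIdempotentElem _).mpr hlin).trace
  rw [Matrix.trace_toLin'_eq] at htr
  generalize Module.finrank ℂ (LinearMap.range (Matrix.toLin' P)) = r at htr
  simp only [hPdef, Matrix.trace_add, Matrix.trace_smul, Matrix.trace_one, smul_eq_mul] at htr
  refine ⟨2 * r - Fintype.card ι, ?_⟩
  push_cast
  rw [← htr]
  field_simp
  ring

theorem isSquare_of_mul_sq_eq_sq {D k m : ℤ} (hm : m ≠ 0) (h : D * k ^ 2 = m ^ 2) :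
    IsSquare D := by
  have hk : k ≠ 0 := by rintro rfl; exact hm (by simpa using h.symm)
  obtain ⟨q, rfl⟩ := (Int.pow_dvd_pow_iff two_ne_zero).mp (Dvd.intro_left D h)
  refine ⟨q, mul_right_cancel₀ (pow_ne_zero 2 hk) ?_⟩
  rw [h]; ring

theorem emod_three_eq_zero_of_sq_eq (q m e : ℤ) (h : q ^ 2 = 9 * (m - e) ^ 2 + 12 * e) :
    e % 3 = 0 := by
  have h3 : (3 : ℤ) ∣ q := by
    refine Int.prime_three.dvd_of_dvd_pow (n := 2) ⟨3 * (m - e) ^ 2 + 4 * e, ?_⟩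
    linarith
  obtain ⟨t, rfl⟩ := h3
  have : 4 * e = 3 * (t ^ 2 - (m - e) ^ 2) := by nlinarith
  omega

theorem ω3_cube : ω3 ^ 3 = 1 := by
  linear_combination (ω3 - 1) * ω3_sq

/-- A Hermitian matrix takes powers of `ω` to their conjugates under transposition. -/
theorem apply_swap_of_eq_ω3_pow {n : ℕ} {Q : Matrix (Fin n) (Fin n) ℂ} (hQ : Q.IsHermitian)
    {i j : Fin n} {t : ℕ} (h : Q i j = ω3 ^ t) : Q j i = (ω3 ^ 2) ^ t := by
  rw [← hQ.apply j i, h, star_pow, star_ω3]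

/-- Comparing the rows `i` and `j` of a standard form matrix with `Q i j = ω`. -/
theorem exists_int_of_apply_eq_ω3 {n : ℕ} {Q : Matrix (Fin n) (Fin n) ℂ} {μ : ℝ}
    (hQ : IsCubeRootSeidel Q) (hsf : IsStandardForm Q)
    (heq : Q ^ 2 = ((n : ℂ) - 1) • (1 : Matrix (Fin n) (Fin n) ℂ) + (μ : ℂ) • Q)
    {i j : Fin n} (hi : i.val ≠ 0) (hj : j.val ≠ 0) (hij : i ≠ j) (hω : Q i j = ω3) :
    ∃ e m : ℤ, (n : ℤ) = 3 * m ∧ 3 * (e : ℝ) = (n : ℝ) - μ - 2 ∧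
      2 * (n : ℤ) ≤ 9 * e ∧ 9 * e ≤ 4 * (n : ℤ) - 9 := by
  obtain ⟨hherm, hdiag, hoff⟩ := hQ
  have hpow (a b : Fin n) : ∃ t : Fin 3, a ≠ b → Q a b = ω3 ^ t.val := by
    by_cases hab : a = b
    · exact ⟨0, fun h => absurd hab h⟩
    · rcases hoff a b hab with h | h | h
      · exact ⟨0, fun _ => by simpa using h⟩
      · exact ⟨1, fun _ => by simpa using h⟩
      · exact ⟨2, fun _ => by simpa using h⟩
  choose x hx using hpow
  let z : Fin n := ⟨0, i.pos⟩
  have hzi : i ≠ z := fun h => hi (congrArg Fin.val h)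
  have hzj : j ≠ z := fun h => hj (congrArg Fin.val h)
  set s : Finset (Fin n) := ((Finset.univ.erase z).erase i).erase j with hs
  have hsplit (f : Fin n → ℂ) : ∑ k, f k = f z + (f i + (f j + ∑ k ∈ s, f k)) := by
    rw [hs, Finset.add_sum_erase _ _ (by simp [hij.symm, hzj]),
      Finset.add_sum_erase _ _ (by simp [hzi]), Finset.add_sum_erase _ _ (Finset.mem_univ z)]
  have hmem {k : Fin n} (hk : k ∈ s) : j ≠ k ∧ i ≠ k ∧ k ≠ z := by
    simp only [hs, Finset.mem_erase, Finset.mem_univ, and_true] at hk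
    exact ⟨hk.1.symm, hk.2.1.symm, hk.2.2⟩
  have hentry (a b : Fin n) (hab : a ≠ b) : ∑ k, Q a k * Q k b = μ * Q a b := by
    have h := congrFun (congrFun heq a) b
    rw [pow_two, Matrix.mul_apply] at h
    simpa [Matrix.one_apply_ne hab] using h
  have hji : Q j i = ω3 ^ 2 := by
    simpa using apply_swap_of_eq_ω3_pow hherm (t := 1) (by simpa using hω)
  have hiz : Q i z = 1 := hsf i z hzi (Or.inr rfl)
  have hjz : Q j z = 1 := hsf j z hzj (Or.inr rfl)
  have hzj' : Q z j = 1 := hsf z j hzj.symm (Or.inl rfl)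
  have row_i : ∑ k ∈ s, ω3 ^ (x i k).val = μ - ω3 := by
    have h := hentry i z hzi
    rw [hsplit, hdiag, hdiag, hjz, hω, hiz,
      Finset.sum_congr rfl (g := fun k => ω3 ^ (x i k).val) fun k hk => by
        rw [hx i k (hmem hk).2.1, hsf k z (hmem hk).2.2 (Or.inr rfl), mul_one]] at h
    linear_combination h
  have row_j : ∑ k ∈ s, ω3 ^ (x j k).val = μ - ω3 ^ 2 := by
    have h := hentry j z hzj
    rw [hsplit, hdiag, hdiag, hiz, hji, hjz,
      Finset.sum_congr rfl (g := fun k => ω3 ^ (x j k).val) fun k hk => by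
        rw [hx j k (hmem hk).1, hsf k z (hmem hk).2.2 (Or.inr rfl), mul_one]] at h
    linear_combination h
  have row_ij : ∑ k ∈ s, ω3 ^ (x i k).val * (ω3 ^ 2) ^ (x j k).val = μ * ω3 - 1 := by
    have h := hentry i j hij
    rw [hsplit, hdiag, hdiag, hiz, hzj', hω,
      Finset.sum_congr rfl (g := fun k => ω3 ^ (x i k).val * (ω3 ^ 2) ^ (x j k).val)
        fun k hk => by
          rw [hx i k (hmem hk).2.1, apply_swap_of_eq_ω3_pow hherm (hx j k (hmem hk).1)]] at h
    linear_combination h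
  have total : ∑ k ∈ s, (1 : ℂ) = n - 3 := by
    have h := hsplit fun _ => 1
    simp only [Finset.sum_const, Finset.card_univ, Fintype.card_fin, nsmul_eq_mul, mul_one]
      at h ⊢
    linear_combination -h
  rw [sum_eq_sum_jointCount s (x i) (x j) fun a _ => ω3 ^ a.val] at row_i
  rw [sum_eq_sum_jointCount s (x i) (x j) fun _ b => ω3 ^ b.val] at row_j
  rw [sum_eq_sum_jointCount s (x i) (x j) fun a b => ω3 ^ a.val * (ω3 ^ 2) ^ b.val] at row_ij
  rw [sum_eq_sum_jointCount s (x i) (x j) fun _ _ => 1] at total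
  generalize jointCount s (x i) (x j) = N at row_i row_j row_ij total
  simp only [Fin.sum_univ_three, Fin.val_zero, Fin.val_one, Fin.val_two] at row_i row_j row_ij total
  obtain ⟨hi0, hi1⟩ := coeff_eq_of_add_mul_ω3_eq_zero
    (p := N 0 0 + N 0 1 + N 0 2 - μ) (q := N 1 0 + N 1 1 + N 1 2 + 1)
    (r := N 2 0 + N 2 1 + N 2 2) (by push_cast; linear_combination row_i)
  obtain ⟨hj0, hj1⟩ := coeff_eq_of_add_mul_ω3_eq_zero
    (p := N 0 0 + N 1 0 + N 2 0 - μ) (q := N 0 1 + N 1 1 + N 2 1)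
    (r := N 0 2 + N 1 2 + N 2 2 + 1) (by push_cast; linear_combination row_j)
  obtain ⟨hd0, hd1⟩ := coeff_eq_of_add_mul_ω3_eq_zero
    (p := N 0 0 + N 1 1 + N 2 2 + 1) (q := N 1 0 + N 2 1 + N 0 2 - μ)
    (r := N 2 0 + N 0 1 + N 1 2) (by
      push_cast
      linear_combination row_ij - (N 1 1 + N 0 2 * ω3 + N 1 2 * ω3 ^ 2 + N 2 1 * ω3
        + N 2 2 * (ω3 ^ 3 + 1)) * ω3_cube)
  have total' : (N 0 0 + N 0 1 + N 0 2 + (N 1 0 + N 1 1 + N 1 2) + (N 2 0 + N 2 1 + N 2 2) : ℕ) + 3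
      = n := by
    have : ((N 0 0 + N 0 1 + N 0 2 + (N 1 0 + N 1 1 + N 1 2) + (N 2 0 + N 2 1 + N 2 2) + 3 : ℕ) : ℂ)
        = n := by
      push_cast
      linear_combination total
    exact_mod_cast this
  obtain ⟨M, rfl⟩ : ∃ M : ℤ, μ = M :=
    ⟨N 0 0 + N 0 1 + N 0 2 - (N 2 0 + N 2 1 + N 2 2), by push_cast; linarith⟩
  norm_cast at hi0 hi1 hj0 hj1 hd0 hd1
  refine ⟨N 2 0 + N 2 1 + N 2 2, n / 3, ?_, ?_, ?_, ?_⟩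
  · push_cast at hi0 hi1 hj0 hj1 hd0 hd1; omega
  · have : 3 * ((N 2 0 + N 2 1 + N 2 2 : ℕ) : ℤ) = n - M - 2 := by push_cast at hi0 hi1 ⊢; omega
    exact_mod_cast this
  · push_cast at hi0 hi1 hj0 hj1 hd0 hd1; omega
  · push_cast at hi0 hi1 hj0 hj1 hd0 hd1; omega

/-- A nontrivial standard form matrix has an entry equal to `ω` outside its first row and column. -/
theorem exists_apply_eq_ω3 {n : ℕ} {Q : Matrix (Fin n) (Fin n) ℂ}
    (hQ : IsCubeRootSeidel Q) (hsf : IsStandardForm Q) (hnt : IsNontrivial Q) :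
    ∃ i j : Fin n, i.val ≠ 0 ∧ j.val ≠ 0 ∧ i ≠ j ∧ Q i j = ω3 := by
  obtain ⟨i, j, hij, h1⟩ := hnt
  have hi : i.val ≠ 0 := fun h => h1 (hsf i j hij (Or.inl h))
  have hj : j.val ≠ 0 := fun h => h1 (hsf i j hij (Or.inr h))
  rcases hQ.2.2 i j hij with h | h | h
  · exact absurd h h1
  · exact ⟨i, j, hi, hj, hij, h⟩
  · refine ⟨j, i, hj, hi, hij.symm, ?_⟩
    rw [apply_swap_of_eq_ω3_pow hQ.1 h]
    linear_combination ω3 * ω3_cube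

/-- If the Seidel matrix has two eigenvalues with nonzero sum `M`, its discriminant is a square. -/
theorem isSquare_discriminant {n : ℕ} {Q : Matrix (Fin n) (Fin n) ℂ} {M : ℤ}
    (hdiag : ∀ i, Q i i = 0) (hn : 1 < n) (hM : M ≠ 0)
    (heq : Q ^ 2 = ((n : ℂ) - 1) • (1 : Matrix (Fin n) (Fin n) ℂ) + (M : ℂ) • Q) :
    IsSquare (M ^ 2 + 4 * (n - 1) : ℤ) := by
  have hD : (0 : ℝ) < M ^ 2 + 4 * (n - 1) := by
    have : (1 : ℝ) < n := by exact_mod_cast hn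
    nlinarith [sq_nonneg (M : ℝ)]
  have hA : ((2 : ℂ) • Q - (M : ℂ) • 1) * ((2 : ℂ) • Q - (M : ℂ) • 1)
      = ((M ^ 2 + 4 * (n - 1) : ℝ) : ℂ) • (1 : Matrix (Fin n) (Fin n) ℂ) := by
    rw [pow_two] at heq
    simp only [sub_mul, mul_sub, smul_mul_assoc, mul_smul_comm, heq, one_mul, mul_one]
    push_cast
    match_scalars <;> ring
  obtain ⟨k, hk⟩ := exists_int_trace_eq_mul_sqrt _ hD hA
  have hQ0 : Q.trace = 0 := by simp [Matrix.trace, hdiag]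
  rw [Matrix.trace_sub, Matrix.trace_smul, Matrix.trace_smul, hQ0, Matrix.trace_one,
    Fintype.card_fin] at hk
  have hk' : -((M : ℝ) * n) = k * √(M ^ 2 + 4 * (n - 1)) := by
    have := congrArg Complex.re hk
    simpa [← Complex.ofReal_intCast] using this
  refine isSquare_of_mul_sq_eq_sq (k := k) (m := M * n) (mul_ne_zero hM (by omega)) ?_
  have : ((M : ℝ) ^ 2 + 4 * (n - 1)) * k ^ 2 = (M * n) ^ 2 := by
    rw [← neg_sq ((M : ℝ) * n), hk', mul_pow, Real.sq_sqrt hD.le]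
    ring
  exact_mod_cast this

theorem cubeRootSeidel_e_integer_mod_three_and_bounds
    (n : ℕ) (Q : Matrix (Fin n) (Fin n) ℂ) (μ : ℝ)
    (hQ : IsCubeRootSeidel Q) (hsf : IsStandardForm Q) (hnt : IsNontrivial Q)
    (heq : Q ^ 2 = ((n : ℂ) - 1) • (1 : Matrix (Fin n) (Fin n) ℂ) + (μ : ℂ) • Q) :
    ∃ e : ℤ, 3 * (e : ℝ) = (n : ℝ) - μ - 2 ∧ e % 3 = 0 ∧
      2 * (n : ℤ) ≤ 9 * e ∧ 9 * e ≤ 4 * (n : ℤ) - 9 := by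
  obtain ⟨i, j, hi, hj, hij, hω⟩ := exists_apply_eq_ω3 hQ hsf hnt
  obtain ⟨e, m, hm, he, hlow, hup⟩ := exists_int_of_apply_eq_ω3 hQ hsf heq hi hj hij hω
  refine ⟨e, he, ?_, hlow, hup⟩
  obtain rfl : μ = (n - 2 - 3 * e : ℤ) := by push_cast; linarith
  obtain ⟨q, hq⟩ := isSquare_discriminant (M := n - 2 - 3 * e) hQ.2.1 (by omega) (by omega)
    (by exact_mod_cast heq)
  refine emod_three_eq_zero_of_sq_eq q m e ?_
  rw [hm] at hq
  linear_combination -hq
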